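/- arXiv:2502.08721 — 2 statements merged into one kernel-verified Lean document; each statement's English description precedes it below -/
import Mathlib

section
/- (Deterministic sampler bound for complement sampling.) Let ω be a finite set with N elements, 1 ≤ K ≤ N−1 and 0 ≤ q ≤ K. Let the pair (S, Q) be drawn uniformly at random from all pairs where S ⊆ ω has |S| = K and Q ⊆ S has |Q| = q (equivalently: S uniform over K-subsets and then Q uniform over q-subsets of S). Then for every function A mapping q-element subsets of ω to elements of ω, Pr[A(Q) ∈ ω∖S] ≤ (N−K)/(N−q). This is the success-probability bound for any deterministic algorithm that sees q distinct samples from S and tries to output an element of the complement S̄ = ω∖S. -/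
open Finset

/-- The set of pairs `(S, Q)` with `S ⊆ ω`, `|S| = K`, `Q ⊆ S`, `|Q| = q`. -/
def samplePairs (ω : Type*) [Fintype ω] [DecidableEq ω] (K q : ℕ) :
    Finset (Finset ω × Finset ω) :=
  Finset.univ.filter (fun p => p.1.card = K ∧ p.2 ⊆ p.1 ∧ p.2.card = q)

/-- The sets of cardinality `K` between `Q` and `T` are counted by a binomial coefficient. -/
theorem card_filter_between {ω : Type*} [Fintype ω] [DecidableEq ω] {Q T : Finset ω}
    (hQT : Q ⊆ T) {K : ℕ} (hK : Q.card ≤ K) :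
    (univ.filter fun S : Finset ω => S.card = K ∧ Q ⊆ S ∧ S ⊆ T).card =
      (T.card - Q.card).choose (K - Q.card) := by
  rw [← card_sdiff_of_subset hQT, ← card_powersetCard]
  refine card_nbij' (· \ Q) (· ∪ Q) ?_ ?_ ?_ ?_
  · intro S hS
    simp only [coe_filter, mem_univ, true_and, Set.mem_ofPred_eq] at hS
    simp only [mem_coe, mem_powersetCard]
    exact ⟨sdiff_subset_sdiff hS.2.2 le_rfl, by rw [card_sdiff_of_subset hS.2.1, hS.1]⟩
  · intro R hR
    simp only [mem_coe, mem_powersetCard] at hR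
    simp only [coe_filter, mem_univ, true_and, Set.mem_ofPred_eq]
    have hd : Disjoint R Q := disjoint_of_subset_left hR.1 sdiff_disjoint
    exact ⟨by rw [card_union_of_disjoint hd]; omega, subset_union_right,
      union_subset (hR.1.trans sdiff_subset) hQT⟩
  · intro S hS
    simp only [coe_filter, mem_univ, true_and, Set.mem_ofPred_eq] at hS
    exact sdiff_union_of_subset hS.2.1
  · intro R hR
    simp only [mem_coe, mem_powersetCard] at hR
    exact union_sdiff_cancel_right (disjoint_of_subset_left hR.1 sdiff_disjoint)

/-- Among the `K`-sets containing `Q`, the proportion avoiding a given point `a` is at most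
`(N - K) / (N - |Q|)`. -/
theorem card_filter_superset_notMem_mul_le {ω : Type*} [Fintype ω] [DecidableEq ω]
    (Q : Finset ω) (a : ω) {K : ℕ} (hQ : Q.card ≤ K) (hK : K < Fintype.card ω) :
    (univ.filter fun S : Finset ω => (S.card = K ∧ Q ⊆ S) ∧ a ∉ S).card *
        (Fintype.card ω - Q.card) ≤
      (univ.filter fun S : Finset ω => S.card = K ∧ Q ⊆ S).card * (Fintype.card ω - K) := by
  by_cases ha : a ∈ Q
  · rw [filter_eq_empty_iff.2 fun S _ h => h.2 (h.1.2 ha)]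
    simp
  have hall := card_filter_between (subset_univ Q) hQ
  have havoid := card_filter_between (T := univ.erase a) (subset_erase.2 ⟨subset_univ Q, ha⟩) hQ
  simp only [subset_univ, and_true, card_univ] at hall
  simp only [subset_erase, subset_univ, true_and, card_erase_of_mem (mem_univ a), card_univ,
    ← and_assoc] at havoid
  rw [hall, havoid]
  have h := Nat.choose_mul_succ_eq (Fintype.card ω - 1 - Q.card) (K - Q.card)
  rw [show Fintype.card ω - 1 - Q.card + 1 = Fintype.card ω - Q.card by omega,
    show Fintype.card ω - Q.card - (K - Q.card) = Fintype.card ω - K by omega] at h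
  exact h.le

theorem card_filter_samplePairs_mul_le {ω : Type*} [Fintype ω] [DecidableEq ω] {K q : ℕ}
    (hqK : q ≤ K) (hK : K < Fintype.card ω) (A : Finset ω → ω) :
    ((samplePairs ω K q).filter (fun p => A p.2 ∉ p.1)).card * (Fintype.card ω - q) ≤
      (samplePairs ω K q).card * (Fintype.card ω - K) := by
  rw [samplePairs, filter_filter, card_filter, card_filter, Fintype.sum_prod_type_right,
    Fintype.sum_prod_type_right, sum_mul, sum_mul]
  refine sum_le_sum fun Q _ => ?_
  rw [← card_filter, ← card_filter]
  by_cases hQ : Q.card = q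
  · subst hQ
    simpa using card_filter_superset_notMem_mul_le Q (A Q) hqK hK
  · simp [hQ]

/-- Deterministic sampler bound for complement sampling: let `|ω| = N`,
`1 ≤ K ≤ N−1`, `0 ≤ q ≤ K`, and draw `(S, Q)` uniformly from all pairs with `|S| = K`,
`Q ⊆ S`, `|Q| = q`. Then every function `A` from observed sample sets to elements of `ω`
satisfies `Pr[A(Q) ∈ ω∖S] ≤ (N−K)/(N−q)`. -/
theorem deterministic_sampler_bound {ω : Type*} [Fintype ω] [DecidableEq ω]
    (N K q : ℕ) (hω : Fintype.card ω = N) (hK1 : 1 ≤ K) (hK2 : K ≤ N - 1) (hqK : q ≤ K)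
    (A : Finset ω → ω) :
    (((samplePairs ω K q).filter (fun p => A p.2 ∉ p.1)).card : ℝ) /
        ((samplePairs ω K q).card : ℝ) ≤ ((N : ℝ) - K) / ((N : ℝ) - q) := by
  have hK : K < Fintype.card ω := by omega
  have h := card_filter_samplePairs_mul_le hqK hK A
  rw [hω] at h hK
  have hNq : (0 : ℝ) < (N : ℝ) - q := sub_pos.2 (by exact_mod_cast hqK.trans_lt hK)
  have hNK : (0 : ℝ) ≤ (N : ℝ) - K := sub_nonneg.2 (by exact_mod_cast hK.le)
  refine div_le_of_le_mul₀ (Nat.cast_nonneg _) (div_nonneg hNK hNq.le) ?_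
  rw [div_mul_eq_mul_div, le_div_iff₀ hNq, mul_comm ((N : ℝ) - K),
    ← Nat.cast_sub hK.le, ← Nat.cast_sub (hqK.trans hK.le)]
  exact_mod_cast h
end

section
/- (Classical query lower bound for complement sampling.) Let ω be a finite set with N elements, 1 ≤ K ≤ N−1, 0 ≤ q ≤ K, and δ ∈ [0, 1/2]. Let the pair (S, Q) be drawn uniformly at random from all pairs where S ⊆ ω has |S| = K and Q ⊆ S has |Q| = q. If there exists a function A mapping q-element subsets of ω to elements of ω with Pr[A(Q) ∈ ω∖S] ≥ 1/2 + δ, then q ≥ N − 2(N−K)/(2δ + 1). -/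
open Finset

/-- Among the `K`-element supersets of `Q`, the fraction avoiding a given point `a` is at most
`(N - K) / (N - |Q|)`. -/
theorem card_supersets_avoiding_mul_le {ω : Type*} [Fintype ω] [DecidableEq ω] {K : ℕ}
    {Q : Finset ω} (hQ : Q.card ≤ K) (a : ω) :
    (((powersetCard K univ).filter (Q ⊆ ·)).filter (a ∉ ·)).card * (Fintype.card ω - Q.card) ≤
      (Fintype.card ω - K) * ((powersetCard K univ).filter (Q ⊆ ·)).card := by
  by_cases ha : a ∈ Q
  · have h : (((powersetCard K univ).filter (Q ⊆ ·)).filter (a ∉ ·)) = ∅ :=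
      filter_eq_empty_iff.2 fun S hS haS => haS ((mem_filter.1 hS).2 ha)
    simp [h]
  · have h : (((powersetCard K univ).filter (Q ⊆ ·)).filter (a ∉ ·)) =
        (powersetCard K (univ.erase a)).filter (Q ⊆ ·) := by
      ext S
      simp only [mem_filter, mem_powersetCard, subset_erase, subset_univ, true_and]
      tauto
    have hQa : Q ⊆ univ.erase a := subset_erase.2 ⟨subset_univ Q, ha⟩
    have hlt : Q.card < Fintype.card ω := by
      have := card_le_card hQa
      rw [card_erase_of_mem (mem_univ a), card_univ] at this
      have := Fintype.card_pos_iff.2 ⟨a⟩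
      omega
    rw [h, card_filter_powersetCard_subset _ _ _ hQa hQ, card_filter_powersetCard_subset _ _ _ (subset_univ Q) hQ,
      card_erase_of_mem (mem_univ a), card_univ]
    obtain ⟨m, hm⟩ : ∃ m, Fintype.card ω - Q.card = m + 1 :=
      ⟨Fintype.card ω - Q.card - 1, by omega⟩
    have hm' : Fintype.card ω - 1 - Q.card = m := by omega
    have hK : Fintype.card ω - K = m + 1 - (K - Q.card) := by omega
    rw [hm, hm', hK, Nat.choose_mul_succ_eq, mul_comm]

/-- The success probability of a `q`-sample algorithm is at most `(N - K) / (N - q)`. -/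
theorem card_successful_samplePairs_mul_le {ω : Type*} [Fintype ω] [DecidableEq ω] {K q : ℕ}
    (hqK : q ≤ K) (A : Finset ω → ω) :
    ((samplePairs ω K q).filter (fun p => A p.2 ∉ p.1)).card * (Fintype.card ω - q) ≤
      (Fintype.card ω - K) * (samplePairs ω K q).card := by
  have hmaps : Set.MapsTo Prod.snd (samplePairs ω K q : Set (Finset ω × Finset ω))
      (powersetCard q (univ : Finset ω)) := fun p hp => by
    simp only [samplePairs, mem_coe, mem_filter] at hp
    simpa using hp.2.2.2
  have hmaps' := hmaps.mono_left (coe_subset.2 (filter_subset (fun p => A p.2 ∉ p.1) _))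
  rw [card_eq_sum_card_fiberwise hmaps, card_eq_sum_card_fiberwise hmaps', sum_mul, mul_sum]
  refine sum_le_sum fun Q hQ => ?_
  have hQq : Q.card = q := (mem_powersetCard.1 hQ).2
  have hinj : Function.Injective fun S : Finset ω => (S, Q) := fun _ _ h => congrArg Prod.fst h
  have h₁ : (samplePairs ω K q).filter (fun p => p.2 = Q) =
      ((powersetCard K univ).filter (Q ⊆ ·)).image fun S => (S, Q) := by
    ext ⟨S, R⟩
    simp only [samplePairs, mem_filter, mem_univ, true_and, mem_image, mem_powersetCard,
      subset_univ, Prod.mk.injEq]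
    grind
  have h₂ : ((samplePairs ω K q).filter (fun p => A p.2 ∉ p.1)).filter (fun p => p.2 = Q) =
      (((powersetCard K univ).filter (Q ⊆ ·)).filter (A Q ∉ ·)).image fun S => (S, Q) := by
    ext ⟨S, R⟩
    simp only [samplePairs, mem_filter, mem_univ, true_and, mem_image, mem_powersetCard,
      subset_univ, Prod.mk.injEq]
    grind
  rw [h₁, h₂, card_image_of_injective _ hinj, card_image_of_injective _ hinj, ← hQq]
  exact card_supersets_avoiding_mul_le (hQq.trans_le hqK) (A Q)

/-- Classical query lower bound for complement sampling: let `|ω| = N`,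
`1 ≤ K ≤ N−1`, `0 ≤ q ≤ K`, `δ ∈ [0, 1/2]`, and draw `(S, Q)` uniformly from all pairs
with `|S| = K`, `Q ⊆ S`, `|Q| = q`. If some function `A` from observed sample sets to
elements of `ω` satisfies `Pr[A(Q) ∈ ω∖S] ≥ 1/2 + δ`, then
`q ≥ N − 2(N−K)/(2δ + 1)`. -/
theorem classical_query_lower_bound {ω : Type*} [Fintype ω] [DecidableEq ω]
    (N K q : ℕ) (hω : Fintype.card ω = N) (hK1 : 1 ≤ K) (hK2 : K ≤ N - 1) (hqK : q ≤ K)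
    (δ : ℝ) (hδ0 : 0 ≤ δ) (hδ1 : δ ≤ 1 / 2)
    (A : Finset ω → ω)
    (hA : (((samplePairs ω K q).filter (fun p => A p.2 ∉ p.1)).card : ℝ) /
        ((samplePairs ω K q).card : ℝ) ≥ 1 / 2 + δ) :
    (q : ℝ) ≥ (N : ℝ) - 2 * ((N : ℝ) - K) / (2 * δ + 1) := by
  have hlt : K < N := by omega
  have hcount := card_successful_samplePairs_mul_le hqK A
  rw [hω] at hcount
  have hcount' : (((samplePairs ω K q).filter (fun p => A p.2 ∉ p.1)).card : ℝ) * ((N : ℝ) - q) ≤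
      ((N : ℝ) - K) * ((samplePairs ω K q).card : ℝ) := by
    rw [← Nat.cast_sub hlt.le, ← Nat.cast_sub (hqK.trans hlt.le)]
    exact_mod_cast hcount
  have hpos : (0 : ℝ) < (samplePairs ω K q).card := by
    refine lt_of_le_of_ne (Nat.cast_nonneg _) fun h => ?_
    rw [← h, div_zero] at hA
    linarith
  have hqN : (0 : ℝ) ≤ (N : ℝ) - q := sub_nonneg.2 (by exact_mod_cast hqK.trans hlt.le)
  rw [ge_iff_le, le_div_iff₀ hpos] at hA
  have hbound : (1 / 2 + δ) * ((N : ℝ) - q) ≤ (N : ℝ) - K := by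
    refine le_of_mul_le_mul_right ?_ hpos
    calc (1 / 2 + δ) * ((N : ℝ) - q) * (samplePairs ω K q).card
        = (1 / 2 + δ) * (samplePairs ω K q).card * ((N : ℝ) - q) := by ring
      _ ≤ _ := (mul_le_mul_of_nonneg_right hA hqN).trans hcount'
  have hdiv : (N : ℝ) - q ≤ 2 * ((N : ℝ) - K) / (2 * δ + 1) := by
    rw [le_div_iff₀ (by linarith)]
    linarith
  linarith
end
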